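/- Monotone comparison of threshold recursions: let λ > 0, let u₁,…,u_n ∈ [0,1], and for a parameter r > 0 define recursively b^r_0 = 0 and b^r_i = b^r_{i−1} + (1/λ)·1{u_i ≥ b^r_{i−1}/r} for i = 1,…,n. Then for all 0 < s ≤ r one has (s/r)·(b^r_n − 1/λ) ≤ b^s_n ≤ b^r_n. -/

import Mathlib

open MeasureTheory Set Filter
open scoped ENNReal NNReal Topology

noncomputable section

/-- The threshold recursion: `b^r_0 = 0` and
`b^r_i = b^r_{i-1} + (1/λ)·1{u_i ≥ b^r_{i-1}/r}`. -/
noncomputable def thrRec (lam r : ℝ) (u : ℕ → ℝ) : ℕ → ℝ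
  | 0 => 0
  | i + 1 => thrRec lam r u i + if thrRec lam r u i / r ≤ u (i + 1) then 1 / lam else 0

theorem thrRec_mul (lam r : ℝ) (u : ℕ → ℝ) (n : ℕ) :
    ∃ k : ℕ, thrRec lam r u n = k * (1 / lam) := by
  induction n with
  | zero => exact ⟨0, by simp [thrRec]⟩
  | succ n ih =>
    obtain ⟨k, hk⟩ := ih
    rw [thrRec]
    split_ifs
    · exact ⟨k + 1, by rw [hk]; push_cast; ring⟩
    · exact ⟨k, by rw [hk]; ring⟩

theorem thrRec_compare (lam : ℝ) (hlam : 0 < lam) (r s : ℝ) (hs : 0 < s) (hsr : s ≤ r)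
    (u : ℕ → ℝ) (n : ℕ) :
    (thrRec lam r u n - 1 / lam) / r ≤ thrRec lam s u n / s ∧
    thrRec lam s u n ≤ thrRec lam r u n := by
  have hr : 0 < r := hs.trans_le hsr
  have hl : 0 < 1 / lam := by positivity
  induction n with
  | zero =>
    refine ⟨?_, by simp [thrRec]⟩
    simp only [thrRec, zero_div]
    exact div_nonpos_of_nonpos_of_nonneg (by linarith) hr.le
  | succ n ih =>
    obtain ⟨h1, h2⟩ := ih
    obtain ⟨j, hj⟩ := thrRec_mul lam r u n
    obtain ⟨k, hk⟩ := thrRec_mul lam s u n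
    have hinv : (1 / lam) / r ≤ (1 / lam) / s := by gcongr
    have hpos : 0 < (1 / lam) / s := by positivity
    simp only [thrRec]
    generalize thrRec lam r u n = a at *
    generalize thrRec lam s u n = b at *
    split_ifs with ha hb hb
    · refine ⟨?_, by linarith⟩
      rw [sub_div] at h1
      rw [sub_div, add_div, add_div]
      linarith
    · refine ⟨?_, by linarith⟩
      rw [add_sub_cancel_right, add_zero]
      linarith
    · refine ⟨?_, ?_⟩
      · rw [add_zero, add_div]
        linarith
      · have hlt : b / s < a / r := by linarith
        have ha0 : 0 ≤ a := by rw [hj]; positivity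
        have h3 : a / r ≤ a / s := by gcongr
        have h4 : b < a := (div_lt_div_iff_of_pos_right hs).1 (hlt.trans_le h3)
        rw [hj, hk] at h4
        have h5 : (k : ℝ) < j := lt_of_mul_lt_mul_right h4 hl.le
        have h6 : (k : ℝ) + 1 ≤ j := by exact_mod_cast h5
        rw [hj, hk]
        nlinarith
    · simpa using ⟨by simpa using h1, h2⟩

/-- Monotone comparison of threshold recursions: for `0 < s ≤ r`,
`(s/r)·(b^r_n − 1/λ) ≤ b^s_n ≤ b^r_n`. -/
theorem statement10 (lam : ℝ) (hlam : 0 < lam) (r s : ℝ) (hs : 0 < s) (hsr : s ≤ r)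
    (n : ℕ) (u : ℕ → ℝ) (hu : ∀ i, 1 ≤ i → i ≤ n → u i ∈ Icc (0:ℝ) 1) :
    (s / r) * (thrRec lam r u n - 1 / lam) ≤ thrRec lam s u n ∧
    thrRec lam s u n ≤ thrRec lam r u n := by
  obtain ⟨h1, h2⟩ := thrRec_compare lam hlam r s hs hsr u n
  refine ⟨?_, h2⟩
  rw [le_div_iff₀ hs] at h1
  calc _ = (thrRec lam r u n - 1 / lam) / r * s := by ring
    _ ≤ _ := h1

end
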